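/- Let $G$ be the graph obtained from the triangle $C_3$ on vertices $x_1,x_2,x_3$ by attaching a path of length three to $x_1$: $V(G) = \{x_1,\ldots,x_6\}$ with edges $E(C_3) \cup \{\{x_1,x_4\},\{x_4,x_5\},\{x_5,x_6\}\}$. Then $G$ enjoys the strong exchange property: for every $\mathfrak{c} \in \mathbb{Z}_{>0}^6$, $\mathcal{W}(\mathfrak{c},G)$ enjoys the strong exchange property. -/

import Mathlib

open Finset

/-- A monomial with exponent vector `a` belongs to the `q`-th power of the edge ideal of `G`:
it is divisible by a product of `q` edges of `G`. -/
def memPow {n : ℕ} (G : SimpleGraph (Fin n)) (q : ℕ) (a : Fin n → ℕ) : Prop :=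
  ∃ e : Fin q → Fin n × Fin n, (∀ i, G.Adj (e i).1 (e i).2) ∧
    ∀ j, (∑ i, ((if (e i).1 = j then 1 else 0) + (if (e i).2 = j then 1 else 0))) ≤ a j

/-- The exponent vector `a` is componentwise bounded by `c`. -/
def bdd {n : ℕ} (c a : Fin n → ℕ) : Prop := ∀ i, a i ≤ c i

/-- `δ_c(I(G))`: the largest `q` such that `(I(G)^q)_c ≠ 0`, i.e. such that some
`c`-bounded monomial lies in `I(G)^q`. -/
noncomputable def deltaC {n : ℕ} (G : SimpleGraph (Fin n)) (c : Fin n → ℕ) : ℕ :=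
  sSup {q | ∃ a, bdd c a ∧ memPow G q a}

/-- `W(c,G)`: the minimal monomial generators of `(I(G)^{δ_c(I(G))})_c`, i.e. the
`c`-bounded monomials of `I(G)^{δ_c}` that are minimal with respect to divisibility. -/
def genW {n : ℕ} (G : SimpleGraph (Fin n)) (c : Fin n → ℕ) : Set (Fin n → ℕ) :=
  {a | bdd c a ∧ memPow G (deltaC G c) a ∧
    ∀ b, bdd a b → memPow G (deltaC G c) b → b = a}

/-- The monomial `x_ρ · u / x_ξ`. -/
def exch {n : ℕ} (u : Fin n → ℕ) (ξ ρ : Fin n) : Fin n → ℕ :=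
  fun i => if i = ρ then u i + 1 else if i = ξ then u i - 1 else u i

/-- `W(c,G)` enjoys the strong exchange property. -/
def SEPc {n : ℕ} (G : SimpleGraph (Fin n)) (c : Fin n → ℕ) : Prop :=
  ∀ u ∈ genW G c, ∀ v ∈ genW G c, ∀ ξ ρ : Fin n, v ξ < u ξ → u ρ < v ρ →
    exch u ξ ρ ∈ genW G c

/-- The graph `G` enjoys the strong exchange property: `W(c,G)` does, for every
`c ∈ ℤ_{>0}^n`. -/
def SEP {n : ℕ} (G : SimpleGraph (Fin n)) : Prop :=
  ∀ c : Fin n → ℕ, (∀ i, 0 < c i) → SEPc G c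

/-- The cycle graph on `Fin m`. -/
def cycleG (m : ℕ) : SimpleGraph (Fin m) :=
  SimpleGraph.fromRel (fun i j => (i.val + 1) % m = j.val)

/-- The path graph on `Fin m`. -/
def pathG (m : ℕ) : SimpleGraph (Fin m) :=
  SimpleGraph.fromRel (fun i j => i.val + 1 = j.val)

/-- A set of monomials is of Veronese type: it equals `w · V^{(d)}(a)`, the set of
translates by a fixed monomial `w` of all monomials of degree `d` componentwise
bounded by `a`. -/
def IsVeronese {n : ℕ} (S : Set (Fin n → ℕ)) : Prop :=
  ∃ (w : Fin n → ℕ) (d : ℕ) (a : Fin n → ℕ), d ≤ ∑ i, a i ∧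
    S = {u | ∃ v : Fin n → ℕ, (∀ i, v i ≤ a i) ∧ (∑ i, v i) = d ∧
      u = fun i => w i + v i}

/-- The graph on `Fin m` with edges given by a list of (0-based) pairs. -/
def listGraph (m : ℕ) (E : List (ℕ × ℕ)) : SimpleGraph (Fin m) :=
  SimpleGraph.fromRel (fun i j => (i.val, j.val) ∈ E)

/-- The triangle on `0,1,2` with a path of length three `0-3-4-5` attached to `0`. -/
def G17 : SimpleGraph (Fin 6) := listGraph 6 [(0,1),(1,2),(0,2),(0,3),(3,4),(4,5)]

theorem memPow_zero {n : ℕ} (G : SimpleGraph (Fin n)) (a : Fin n → ℕ) : memPow G 0 a :=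
  ⟨Fin.elim0, fun i => i.elim0, fun j => by simp⟩

theorem memPow.succ {n : ℕ} {G : SimpleGraph (Fin n)} {q : ℕ} {a b : Fin n → ℕ}
    (h : memPow G q a) {i j : Fin n} (hij : G.Adj i j)
    (hb : ∀ k, a k + ((if i = k then 1 else 0) + (if j = k then 1 else 0)) ≤ b k) :
    memPow G (q + 1) b := by
  obtain ⟨e, he, hle⟩ := h
  refine ⟨Fin.cons (i, j) e, fun k => ?_, fun k => ?_⟩
  · cases k using Fin.cases with
    | zero => simpa using hij
    | succ k => simpa using he k
  · rw [Fin.sum_univ_succ]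
    simp only [Fin.cons_zero, Fin.cons_succ]
    have := hle k
    have := hb k
    omega

theorem memPow.add_edges {n : ℕ} {G : SimpleGraph (Fin n)} {q : ℕ} {a : Fin n → ℕ}
    (h : memPow G q a) {i j : Fin n} (hij : G.Adj i j) (m : ℕ) :
    memPow G (q + m)
      (fun k => a k + m * ((if i = k then 1 else 0) + (if j = k then 1 else 0))) := by
  induction m with
  | zero => simpa using h
  | succ m ih => exact ih.succ hij fun k => by rw [Nat.succ_mul, add_assoc]

/-- The exponent vector of `x₀x₁^p · x₁x₂^q · x₀x₂^r · x₀x₃^s · x₃x₄^t · x₄x₅^w`. -/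
def edgeProd (p q r s t w : ℕ) : Fin 6 → ℕ :=
  ![p + r + s, p + q, q + r, s + t, t + w, w]

theorem G17_adj_cases {i j : Fin 6} (h : G17.Adj i j) :
    (i, j) ∈ [(0, 1), (1, 2), (0, 2), (0, 3), (3, 4), (4, 5),
      ((1 : Fin 6), (0 : Fin 6)), (2, 1), (2, 0), (3, 0), (4, 3), (5, 4)] := by
  revert i j
  simp only [G17, listGraph, SimpleGraph.fromRel_adj]
  decide

theorem exists_edgeProd {q : ℕ} (e : Fin q → Fin 6 × Fin 6)
    (he : ∀ i, G17.Adj (e i).1 (e i).2) :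
    ∃ p r₁ r s t w, p + r₁ + r + s + t + w = q ∧
      ∀ j, (∑ i, ((if (e i).1 = j then 1 else 0) + (if (e i).2 = j then 1 else 0))) =
        edgeProd p r₁ r s t w j := by
  induction q with
  | zero => exact ⟨0, 0, 0, 0, 0, 0, rfl, fun j => by fin_cases j <;> rfl⟩
  | succ q ih =>
    obtain ⟨p, r₁, r, s, t, w, hsum, hdeg⟩ := ih (fun i => e i.succ) fun i => he i.succ
    have h0 := G17_adj_cases (he 0)
    simp only [Fin.sum_univ_succ, hdeg]
    generalize e 0 = x at h0
    obtain ⟨x, y⟩ := x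
    simp only [List.mem_cons, Prod.mk.injEq, List.not_mem_nil, or_false] at h0
    rcases h0 with h | h | h | h | h | h | h | h | h | h | h | h <;> obtain ⟨rfl, rfl⟩ := h
    on_goal 1 => refine ⟨p + 1, r₁, r, s, t, w, by omega, fun j => ?_⟩
    on_goal 2 => refine ⟨p, r₁ + 1, r, s, t, w, by omega, fun j => ?_⟩
    on_goal 3 => refine ⟨p, r₁, r + 1, s, t, w, by omega, fun j => ?_⟩
    on_goal 4 => refine ⟨p, r₁, r, s + 1, t, w, by omega, fun j => ?_⟩
    on_goal 5 => refine ⟨p, r₁, r, s, t + 1, w, by omega, fun j => ?_⟩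
    on_goal 6 => refine ⟨p, r₁, r, s, t, w + 1, by omega, fun j => ?_⟩
    on_goal 7 => refine ⟨p + 1, r₁, r, s, t, w, by omega, fun j => ?_⟩
    on_goal 8 => refine ⟨p, r₁ + 1, r, s, t, w, by omega, fun j => ?_⟩
    on_goal 9 => refine ⟨p, r₁, r + 1, s, t, w, by omega, fun j => ?_⟩
    on_goal 10 => refine ⟨p, r₁, r, s + 1, t, w, by omega, fun j => ?_⟩
    on_goal 11 => refine ⟨p, r₁, r, s, t + 1, w, by omega, fun j => ?_⟩
    on_goal 12 => refine ⟨p, r₁, r, s, t, w + 1, by omega, fun j => ?_⟩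
    all_goals fin_cases j <;> simp [edgeProd] <;> omega

theorem memPow_edgeProd (p q r s t w : ℕ) :
    memPow G17 (p + q + r + s + t + w) (edgeProd p q r s t w) := by
  have adj : ∀ i j : Fin 6, (i, j) ∈ [(0, 1), (1, 2), (0, 2), (0, 3), (3, 4),
      ((4 : Fin 6), (5 : Fin 6))] → G17.Adj i j := by
    simp only [G17, listGraph, SimpleGraph.fromRel_adj]
    decide
  have h := ((((((memPow_zero G17 0).add_edges (adj 0 1 (by simp)) p).add_edges
    (adj 1 2 (by simp)) q).add_edges (adj 0 2 (by simp)) r).add_edges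
    (adj 0 3 (by simp)) s).add_edges (adj 3 4 (by simp)) t).add_edges (adj 4 5 (by simp)) w
  rw [zero_add] at h
  convert h using 1
  funext j
  fin_cases j <;> simp [edgeProd]

theorem memPow_G17_iff {m : ℕ} {a : Fin 6 → ℕ} :
    memPow G17 m a ↔
      ∃ p q r s t w, p + q + r + s + t + w = m ∧ bdd a (edgeProd p q r s t w) := by
  constructor
  · rintro ⟨e, he, hle⟩
    obtain ⟨p, q, r, s, t, w, hsum, hdeg⟩ := exists_edgeProd e he
    exact ⟨p, q, r, s, t, w, hsum, fun j => hdeg j ▸ hle j⟩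
  · rintro ⟨p, q, r, s, t, w, rfl, hle⟩
    obtain ⟨e, he, h⟩ := memPow_edgeProd p q r s t w
    exact ⟨e, he, fun j => (h j).trans (hle j)⟩

theorem bdd_edgeProd {c : Fin 6 → ℕ} {p q r s t w : ℕ} :
    bdd c (edgeProd p q r s t w) ↔ p + r + s ≤ c 0 ∧ p + q ≤ c 1 ∧ q + r ≤ c 2 ∧
      s + t ≤ c 3 ∧ t + w ≤ c 4 ∧ w ≤ c 5 := by
  simp [bdd, edgeProd, Fin.forall_fin_succ]

theorem le_deltaC {c : Fin 6 → ℕ} {p q r s t w : ℕ} (h : bdd c (edgeProd p q r s t w)) :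
    p + q + r + s + t + w ≤ deltaC G17 c := by
  refine le_csSup ⟨∑ i, c i, ?_⟩ ⟨_, h, memPow_edgeProd p q r s t w⟩
  rintro m ⟨a, ha, hm⟩
  obtain ⟨p, q, r, s, t, w, rfl, hle⟩ := memPow_G17_iff.1 hm
  have := bdd_edgeProd.1 fun i => (hle i).trans (ha i)
  simp only [Fin.sum_univ_six]
  omega

theorem mem_genW_G17_iff {c u : Fin 6 → ℕ} :
    u ∈ genW G17 c ↔ bdd c u ∧ ∃ p q r s t w,
      p + q + r + s + t + w = deltaC G17 c ∧ u = edgeProd p q r s t w := by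
  constructor
  · rintro ⟨hc, hm, hmin⟩
    obtain ⟨p, q, r, s, t, w, hsum, hle⟩ := memPow_G17_iff.1 hm
    exact ⟨hc, p, q, r, s, t, w, hsum,
      (hmin _ hle (hsum ▸ memPow_edgeProd p q r s t w)).symm⟩
  · rintro ⟨hc, p, q, r, s, t, w, hsum, rfl⟩
    refine ⟨hc, hsum ▸ memPow_edgeProd p q r s t w, fun b hb hm => ?_⟩
    obtain ⟨p', q', r', s', t', w', hsum', hle⟩ := memPow_G17_iff.1 hm
    have h1 := bdd_edgeProd.1 hle
    have h2 : ∀ i, b i ≤ edgeProd p q r s t w i := hb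
    simp only [edgeProd, Fin.forall_fin_succ] at h2
    simp at h2
    funext j
    fin_cases j <;> simp [edgeProd] <;> omega

/-- Exponent vectors of products of edges, described by linear inequalities. -/
theorem exists_eq_edgeProd {u : Fin 6 → ℕ} {m : ℕ} (hsum : ∑ i, u i = 2 * m)
    (hp : u 2 + u 3 + u 5 ≤ u 0 + u 4 + u 1) (hq : u 0 + u 4 ≤ u 1 + u 2 + u 3 + u 5)
    (hr : u 1 + u 3 + u 5 ≤ u 0 + u 4 + u 2) (hs : u 4 ≤ u 3 + u 5) (ht : u 5 ≤ u 4) :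
    ∃ p q r s t w, p + q + r + s + t + w = m ∧ u = edgeProd p q r s t w := by
  simp only [Fin.sum_univ_six] at hsum
  refine ⟨(u 0 + u 4 + u 1 - (u 2 + u 3 + u 5)) / 2, (u 1 + u 2 + u 3 + u 5 - (u 0 + u 4)) / 2,
    (u 0 + u 4 + u 2 - (u 1 + u 3 + u 5)) / 2, u 3 + u 5 - u 4, u 4 - u 5, u 5, by omega, ?_⟩
  funext j
  fin_cases j <;> simp [edgeProd] <;> omega

set_option maxHeartbeats 2000000 in
/-- The graph obtained from a triangle by attaching a path of length three
to one of its vertices enjoys the strong exchange property. -/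
theorem stmt17 : SEP G17 := by
  intro c _ u hu v hv ξ ρ hξ hρ
  rw [mem_genW_G17_iff] at hu hv ⊢
  obtain ⟨hcu, p, q, r, s, t, w, hN, rfl⟩ := hu
  obtain ⟨hcv, p', q', r', s', t', w', hN', hv⟩ := hv
  refine ⟨fun i => ?_, ?_⟩
  · have := hcv ρ
    have := hcu i
    unfold exch
    split_ifs with h <;> [subst h; skip; skip] <;> omega
  have hmax : ∀ {p q r s t w : ℕ}, _ := fun {p q r s t w} h =>
    le_deltaC (bdd_edgeProd (c := c) (p := p) (q := q) (r := r) (s := s) (t := t) (w := w) |>.2 h)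
  generalize deltaC G17 c = N at *
  rw [hv] at hcv hξ hρ
  rw [bdd_edgeProd] at hcu hcv
  simp only [edgeProd] at hξ hρ
  fin_cases ρ
  · simp at hρ
    have a01 : c 1 ≤ p + q := by
      have := @hmax (p + 1) q r s t w; omega
    have a02 : c 2 ≤ q + r := by
      have := @hmax p q (r + 1) s t w; omega
    have a03 : c 3 ≤ s + t := by
      have := @hmax p q r (s + 1) t w; omega
    have a05 : t = 0 ∨ c 5 ≤ w := by
      have := @hmax p q r (s + 1) (t - 1) (w + 1); omega
    have a00 : q = 0 ∨ c 0 ≤ p + r + s + 1 := by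
      have := @hmax (p + 1) (q - 1) (r + 1) s t w; omega
    clear hmax hcu
    apply exists_eq_edgeProd <;> fin_cases ξ <;>
      simp [exch, edgeProd, Fin.sum_univ_six] at hξ ⊢ <;> omega
  · simp at hρ
    have a01 : c 0 ≤ p + r + s := by
      have := @hmax (p + 1) q r s t w; omega
    have a12 : c 2 ≤ q + r := by
      have := @hmax p (q + 1) r s t w; omega
    have a13 : r = 0 ∨ c 3 ≤ s + t := by
      have := @hmax p (q + 1) (r - 1) (s + 1) t w; omega
    have a15 : r = 0 ∨ t = 0 ∨ c 5 ≤ w := by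
      have := @hmax p (q + 1) (r - 1) (s + 1) (t - 1) (w + 1); omega
    have a11 : r = 0 ∨ c 1 ≤ p + q + 1 := by
      have := @hmax (p + 1) (q + 1) (r - 1) s t w; omega
    have a14 : s = 0 ∨ c 4 ≤ t + w := by
      have := @hmax (p + 1) q r (s - 1) (t + 1) w; omega
    clear hmax hcu
    apply exists_eq_edgeProd <;> fin_cases ξ <;>
      simp [exch, edgeProd, Fin.sum_univ_six] at hξ ⊢ <;> omega
  · simp at hρ
    have a02 : c 0 ≤ p + r + s := by
      have := @hmax p q (r + 1) s t w; omega
    have a12 : c 1 ≤ p + q := by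
      have := @hmax p (q + 1) r s t w; omega
    have a23 : p = 0 ∨ c 3 ≤ s + t := by
      have := @hmax (p - 1) (q + 1) r (s + 1) t w; omega
    have a25 : p = 0 ∨ t = 0 ∨ c 5 ≤ w := by
      have := @hmax (p - 1) (q + 1) r (s + 1) (t - 1) (w + 1); omega
    have a22 : p = 0 ∨ c 2 ≤ q + r + 1 := by
      have := @hmax (p - 1) (q + 1) (r + 1) s t w; omega
    have a24 : s = 0 ∨ c 4 ≤ t + w := by
      have := @hmax p q (r + 1) (s - 1) (t + 1) w; omega
    clear hmax hcu
    apply exists_eq_edgeProd <;> fin_cases ξ <;>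
      simp [exch, edgeProd, Fin.sum_univ_six] at hξ ⊢ <;> omega
  · simp at hρ
    have a03 : c 0 ≤ p + r + s := by
      have := @hmax p q r (s + 1) t w; omega
    have a34 : c 4 ≤ t + w := by
      have := @hmax p q r s (t + 1) w; omega
    have a13 : r = 0 ∨ c 1 ≤ p + q := by
      have := @hmax p (q + 1) (r - 1) (s + 1) t w; omega
    have a23 : p = 0 ∨ c 2 ≤ q + r := by
      have := @hmax (p - 1) (q + 1) r (s + 1) t w; omega
    have a33 : p = 0 ∨ r = 0 ∨ c 3 ≤ s + t + 1 := by
      have := @hmax (p - 1) (q + 1) (r - 1) (s + 2) t w; omega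
    have a12 : c 1 ≤ p + q ∨ c 2 ≤ q + r := by
      have := @hmax p (q + 1) r s t w; omega
    clear hmax hcu
    apply exists_eq_edgeProd <;> fin_cases ξ <;>
      simp [exch, edgeProd, Fin.sum_univ_six] at hξ ⊢ <;> omega
  · simp at hρ
    have a34 : c 3 ≤ s + t := by
      have := @hmax p q r s (t + 1) w; omega
    have a45 : c 5 ≤ w := by
      have := @hmax p q r s t (w + 1); omega
    have a14 : s = 0 ∨ c 1 ≤ p + q := by
      have := @hmax (p + 1) q r (s - 1) (t + 1) w; omega
    have a24 : s = 0 ∨ c 2 ≤ q + r := by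
      have := @hmax p q (r + 1) (s - 1) (t + 1) w; omega
    clear hmax hcu
    apply exists_eq_edgeProd <;> fin_cases ξ <;>
      simp [exch, edgeProd, Fin.sum_univ_six] at hξ ⊢ <;> omega
  · simp at hρ
    have a45 : c 4 ≤ t + w := by
      have := @hmax p q r s t (w + 1); omega
    have a05 : t = 0 ∨ c 0 ≤ p + r + s := by
      have := @hmax p q r (s + 1) (t - 1) (w + 1); omega
    have a15 : r = 0 ∨ t = 0 ∨ c 1 ≤ p + q := by
      have := @hmax p (q + 1) (r - 1) (s + 1) (t - 1) (w + 1); omega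
    have a25 : p = 0 ∨ t = 0 ∨ c 2 ≤ q + r := by
      have := @hmax (p - 1) (q + 1) r (s + 1) (t - 1) (w + 1); omega
    have a12 : c 1 ≤ p + q ∨ c 2 ≤ q + r := by
      have := @hmax p (q + 1) r s t w; omega
    clear hmax hcu
    apply exists_eq_edgeProd <;> fin_cases ξ <;>
      simp [exch, edgeProd, Fin.sum_univ_six] at hξ ⊢ <;> omega
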